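/- Let k be a field and A = k[h^{±1}](σ_inv, 1) with σ_inv(h) = h^{-1}. Then the center Z(A) equals the k-subalgebra of A generated by h + h^{-1}, x^2 and x^{-2}, and Z(A) is isomorphic as a k-algebra to k[t][s^{±1}], the Laurent polynomial ring in s over the polynomial ring k[t] (via t ↦ h + h^{-1} and s ↦ x^2); in particular h + h^{-1} and x^2 are algebraically independent over k. -/

import Mathlib

open LaurentPolynomial

/-- The defining relations of the degree-one generalized Weyl algebra `k[h^{±1}](σ, a)`:
the generators `Sum.inl p` (for `p` a Laurent polynomial) give a copy of `k[h^{±1}]`,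
and the generators `x = Sum.inr 0` and `y = Sum.inr 1` satisfy
`y x = a`, `x y = σ a`, `x r = σ(r) x` and `y r = σ⁻¹(r) y` for all `r ∈ k[h^{±1}]`. -/
inductive GWARel (k : Type*) [CommRing k] (σ : LaurentPolynomial k ≃ₐ[k] LaurentPolynomial k)
    (a : LaurentPolynomial k) :
    FreeAlgebra k (LaurentPolynomial k ⊕ Fin 2) →
      FreeAlgebra k (LaurentPolynomial k ⊕ Fin 2) → Prop
  | add (r s : LaurentPolynomial k) :
      GWARel k σ a (FreeAlgebra.ι k (Sum.inl (r + s)))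
        (FreeAlgebra.ι k (Sum.inl r) + FreeAlgebra.ι k (Sum.inl s))
  | mul (r s : LaurentPolynomial k) :
      GWARel k σ a (FreeAlgebra.ι k (Sum.inl (r * s)))
        (FreeAlgebra.ι k (Sum.inl r) * FreeAlgebra.ι k (Sum.inl s))
  | smul (c : k) (r : LaurentPolynomial k) :
      GWARel k σ a (FreeAlgebra.ι k (Sum.inl (c • r))) (c • FreeAlgebra.ι k (Sum.inl r))
  | one : GWARel k σ a (FreeAlgebra.ι k (Sum.inl 1)) 1
  | xr (r : LaurentPolynomial k) :
      GWARel k σ a (FreeAlgebra.ι k (Sum.inr 0) * FreeAlgebra.ι k (Sum.inl r))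
        (FreeAlgebra.ι k (Sum.inl (σ r)) * FreeAlgebra.ι k (Sum.inr 0))
  | yr (r : LaurentPolynomial k) :
      GWARel k σ a (FreeAlgebra.ι k (Sum.inr 1) * FreeAlgebra.ι k (Sum.inl r))
        (FreeAlgebra.ι k (Sum.inl (σ.symm r)) * FreeAlgebra.ι k (Sum.inr 1))
  | yx : GWARel k σ a (FreeAlgebra.ι k (Sum.inr 1) * FreeAlgebra.ι k (Sum.inr 0))
        (FreeAlgebra.ι k (Sum.inl a))
  | xy : GWARel k σ a (FreeAlgebra.ι k (Sum.inr 0) * FreeAlgebra.ι k (Sum.inr 1))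
        (FreeAlgebra.ι k (Sum.inl (σ a)))

/-- The degree-one generalized Weyl algebra `k[h^{±1}](σ, a)`, presented as the quotient of
the free algebra on `k[h^{±1}] ⊕ {x, y}` by the generalized Weyl relations. -/
abbrev GWA (k : Type*) [CommRing k] (σ : LaurentPolynomial k ≃ₐ[k] LaurentPolynomial k)
    (a : LaurentPolynomial k) :=
  RingQuot (GWARel k σ a)

namespace GWA

variable {k : Type*} [CommRing k] (σ : LaurentPolynomial k ≃ₐ[k] LaurentPolynomial k)
  (a : LaurentPolynomial k)

/-- The copy of the Laurent polynomial `p` inside the generalized Weyl algebra. -/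
noncomputable def r (p : LaurentPolynomial k) : GWA k σ a :=
  RingQuot.mkAlgHom k (GWARel k σ a) (FreeAlgebra.ι k (Sum.inl p))

/-- The element `h` of the generalized Weyl algebra. -/
noncomputable def H : GWA k σ a := r σ a (T 1)

/-- The element `h⁻¹` of the generalized Weyl algebra. -/
noncomputable def Hinv : GWA k σ a := r σ a (T (-1))

/-- The generator `x` of the generalized Weyl algebra. -/
noncomputable def x : GWA k σ a :=
  RingQuot.mkAlgHom k (GWARel k σ a) (FreeAlgebra.ι k (Sum.inr 0))

/-- The generator `y` of the generalized Weyl algebra. -/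
noncomputable def y : GWA k σ a :=
  RingQuot.mkAlgHom k (GWARel k σ a) (FreeAlgebra.ι k (Sum.inr 1))

end GWA

/-- An element `a ∈ k[h^{±1}]` is a monomial if `a = c·hⁱ` for some `c ∈ k`, `i ∈ ℤ`. -/
def LaurentPolynomial.IsMonomial {k : Type*} [CommRing k] (a : LaurentPolynomial k) : Prop :=
  ∃ (c : k) (i : ℤ), a = C c * T i

namespace GWA

section Presentation

variable {k : Type*} [CommRing k] (σ : LaurentPolynomial k ≃ₐ[k] LaurentPolynomial k)
  (a : LaurentPolynomial k)

theorem x_mul_r (p : LaurentPolynomial k) : x σ a * r σ a p = r σ a (σ p) * x σ a := by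
  simpa only [map_mul, x, y, r] using RingQuot.mkAlgHom_rel k (GWARel.xr (σ := σ) (a := a) p)

theorem y_mul_r (p : LaurentPolynomial k) : y σ a * r σ a p = r σ a (σ.symm p) * y σ a := by
  simpa only [map_mul, x, y, r] using RingQuot.mkAlgHom_rel k (GWARel.yr (σ := σ) (a := a) p)

theorem y_mul_x : y σ a * x σ a = r σ a a := by
  simpa only [map_mul, x, y, r] using RingQuot.mkAlgHom_rel k (GWARel.yx (σ := σ) (a := a))

theorem x_mul_y : x σ a * y σ a = r σ a (σ a) := by
  simpa only [map_mul, x, y, r] using RingQuot.mkAlgHom_rel k (GWARel.xy (σ := σ) (a := a))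

/-- The inclusion of the Laurent polynomials into the generalized Weyl algebra. -/
noncomputable def rHom : LaurentPolynomial k →ₐ[k] GWA k σ a :=
  AlgHom.ofLinearMap
    { toFun := r σ a
      map_add' := fun p q => by
        simpa only [map_add, r] using RingQuot.mkAlgHom_rel k (GWARel.add (σ := σ) (a := a) p q)
      map_smul' := fun c p => by
        simpa only [map_smul, r, RingHom.id_apply] using
          RingQuot.mkAlgHom_rel k (GWARel.smul (σ := σ) (a := a) c p) }
    (by simpa only [map_one, r] using! RingQuot.mkAlgHom_rel k (GWARel.one (σ := σ) (a := a)))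
    (fun p q => by
      simpa only [map_mul, r] using! RingQuot.mkAlgHom_rel k (GWARel.mul (σ := σ) (a := a) p q))

theorem rHom_apply (p : LaurentPolynomial k) : rHom σ a p = r σ a p := rfl

theorem r_one : r σ a 1 = 1 := map_one (rHom σ a)

theorem r_mul (p q : LaurentPolynomial k) : r σ a (p * q) = r σ a p * r σ a q :=
  map_mul (rHom σ a) p q

/-- A subalgebra containing the generators is everything. -/
theorem mem_of_generators {S : Subalgebra k (GWA k σ a)} (hr : ∀ p, r σ a p ∈ S)
    (hx : x σ a ∈ S) (hy : y σ a ∈ S) (z : GWA k σ a) : z ∈ S := by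
  obtain ⟨w, rfl⟩ := RingQuot.mkAlgHom_surjective k (GWARel k σ a) z
  induction w using FreeAlgebra.induction with
  | grade0 c => rw [AlgHom.commutes]; exact S.algebraMap_mem c
  | grade1 g =>
    rcases g with p | i
    · exact hr p
    · fin_cases i
      · exact hx
      · exact hy
  | mul u v hu hv => rw [map_mul]; exact S.mul_mem hu hv
  | add u v hu hv => rw [map_add]; exact S.add_mem hu hv

theorem mem_center_of_commute {z : GWA k σ a} (hr : ∀ p, Commute (r σ a p) z)
    (hx : Commute (x σ a) z) (hy : Commute (y σ a) z) : z ∈ Subalgebra.center k (GWA k σ a) := by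
  rw [Subalgebra.mem_center_iff]
  intro b
  have := mem_of_generators σ a (S := Subalgebra.centralizer k {z})
    (fun p => by simpa [Subalgebra.mem_centralizer_iff] using (hr p).symm.eq)
    (by simpa [Subalgebra.mem_centralizer_iff] using hx.symm.eq)
    (by simpa [Subalgebra.mem_centralizer_iff] using hy.symm.eq) b
  rw [Subalgebra.mem_centralizer_iff] at this
  exact (this z rfl).symm

end Presentation

section One

variable {k : Type*} [CommRing k] (σ : LaurentPolynomial k ≃ₐ[k] LaurentPolynomial k)

/-- For `a = 1` the generator `x` is a unit with inverse `y`. -/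
noncomputable def xUnit : (GWA k σ 1)ˣ where
  val := x σ 1
  inv := y σ 1
  val_inv := by rw [x_mul_y, map_one, r_one]
  inv_val := by rw [y_mul_x, r_one]

/-- The left regular representation on formal sums `∑ pᵢ xⁱ`, encoded as functions on `ℤ`. -/
noncomputable def rep : GWA k σ 1 →ₐ[k] Module.End k (ℤ → LaurentPolynomial k) :=
  RingQuot.liftAlgHom k ⟨FreeAlgebra.lift k (Sum.elim
    (fun p => LinearMap.pi fun i => (LinearMap.mulLeft k p).comp (LinearMap.proj i))
    ![LinearMap.pi fun i => σ.toLinearMap.comp (LinearMap.proj (i - 1)),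
      LinearMap.pi fun i => σ.symm.toLinearMap.comp (LinearMap.proj (i + 1))]), by
    intro u v h
    cases h <;> ext f i : 2 <;> simp [add_mul]⟩

theorem rep_r (p : LaurentPolynomial k) (f : ℤ → LaurentPolynomial k) (i : ℤ) :
    rep σ (r σ 1 p) f i = p * f i := by
  simp [rep, r]

theorem rep_x (f : ℤ → LaurentPolynomial k) (i : ℤ) :
    rep σ (x σ 1) f i = σ (f (i - 1)) := by
  simp [rep, x]

theorem rep_y (f : ℤ → LaurentPolynomial k) (i : ℤ) :
    rep σ (y σ 1) f i = σ.symm (f (i + 1)) := by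
  simp [rep, y]

/-- The coefficients `pᵢ` of an element `∑ pᵢ xⁱ`. -/
noncomputable def coeff : GWA k σ 1 →ₗ[k] ℤ → LaurentPolynomial k :=
  (LinearMap.applyₗ (Pi.single 0 1)).comp (rep σ).toLinearMap

theorem coeff_apply (z : GWA k σ 1) : coeff σ z = rep σ z (Pi.single 0 1) := rfl

theorem coeff_mul (z w : GWA k σ 1) : coeff σ (z * w) = rep σ z (coeff σ w) := by
  simp [coeff_apply]

theorem coeff_xUnit_zpow (i : ℤ) : coeff σ ((xUnit σ ^ i : (GWA k σ 1)ˣ) : GWA k σ 1) =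
    Pi.single i 1 := by
  induction i using Int.induction_on with
  | zero => simp [coeff_apply]
  | succ n ih =>
    rw [add_comm, zpow_one_add, Units.val_mul, coeff_mul, ih]
    ext1 j
    change rep σ (x σ 1) _ j = _
    by_cases h : j = 1 + n
    · subst h; simp [rep_x]
    · rw [rep_x, Pi.single_eq_of_ne (by lia), Pi.single_eq_of_ne h, map_zero]
  | pred n ih =>
    rw [sub_eq_neg_add, zpow_add, zpow_neg_one, Units.val_mul, coeff_mul, ih]
    ext1 j
    change rep σ (y σ 1) _ j = _
    by_cases h : j = -1 + -n
    · subst h; simp [rep_y]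
    · rw [rep_y, Pi.single_eq_of_ne (by lia), Pi.single_eq_of_ne h, map_zero]

/-- The element `∑ pᵢ xⁱ` with prescribed coefficients. -/
noncomputable def ofCoeff : (ℤ →₀ LaurentPolynomial k) →ₗ[k] GWA k σ 1 :=
  Finsupp.lsum k fun i =>
    (LinearMap.mulRight k ((xUnit σ ^ i : (GWA k σ 1)ˣ) : GWA k σ 1)).comp (rHom σ 1).toLinearMap

theorem ofCoeff_single (i : ℤ) (p : LaurentPolynomial k) :
    ofCoeff σ (Finsupp.single i p) = r σ 1 p * ((xUnit σ ^ i : (GWA k σ 1)ˣ) : GWA k σ 1) := by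
  rw [ofCoeff, Finsupp.lsum_single]
  rfl

theorem coeff_ofCoeff (f : ℤ →₀ LaurentPolynomial k) : coeff σ (ofCoeff σ f) = f := by
  induction f using Finsupp.induction_linear with
  | zero => simp
  | add f g hf hg => rw [map_add, map_add, hf, hg, Finsupp.coe_add]
  | single i p =>
    rw [ofCoeff_single, coeff_mul, coeff_xUnit_zpow, Finsupp.single_eq_pi_single]
    ext1 j
    rw [rep_r]
    by_cases h : j = i
    · subst h; simp
    · simp [h]

theorem ofCoeff_surjective : Function.Surjective (ofCoeff σ) := by
  have key : ∀ z : GWA k σ 1, ∀ w ∈ LinearMap.range (ofCoeff σ),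
      z * w ∈ LinearMap.range (ofCoeff σ) := by
    let S : Subalgebra k (GWA k σ 1) :=
      { carrier := {z | ∀ w ∈ LinearMap.range (ofCoeff σ), z * w ∈ LinearMap.range (ofCoeff σ)}
        mul_mem' := fun hz hw u hu => by rw [mul_assoc]; exact hz _ (hw _ hu)
        add_mem' := fun hz hw u hu => by rw [add_mul]; exact add_mem (hz _ hu) (hw _ hu)
        algebraMap_mem' := fun c u hu => by
          rw [← Algebra.smul_def]; exact Submodule.smul_mem _ c hu }
    have mem_S {z : GWA k σ 1} (h : ∀ i p, z * ofCoeff σ (Finsupp.single i p) ∈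
        LinearMap.range (ofCoeff σ)) : z ∈ S := by
      rintro _ ⟨f, rfl⟩
      induction f using Finsupp.induction_linear with
      | zero => simp
      | add f g hf hg => rw [map_add, mul_add]; exact add_mem hf hg
      | single i p => exact h i p
    refine mem_of_generators σ 1 (S := S) (fun q => mem_S fun i p => ?_)
      (mem_S fun i p => ?_) (mem_S fun i p => ?_)
    · exact ⟨Finsupp.single i (q * p), by rw [ofCoeff_single, ofCoeff_single, r_mul, mul_assoc]⟩
    · refine ⟨Finsupp.single (1 + i) (σ p), ?_⟩
      rw [ofCoeff_single, ofCoeff_single, zpow_add, zpow_one, Units.val_mul, ← mul_assoc,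
        ← mul_assoc, x_mul_r]
      rfl
    · refine ⟨Finsupp.single (-1 + i) (σ.symm p), ?_⟩
      rw [ofCoeff_single, ofCoeff_single, zpow_add, zpow_neg_one, Units.val_mul, ← mul_assoc,
        ← mul_assoc, y_mul_r]
      rfl
  intro z
  have h := key z 1 ⟨Finsupp.single 0 1, by simp [ofCoeff_single, r_one]⟩
  rwa [mul_one] at h

/-- An operator commuting with the action of the generators commutes with the whole action. -/
theorem rep_commute {D : Module.End k (ℤ → LaurentPolynomial k)}
    (hr : ∀ p, Commute D (rep σ (r σ 1 p))) (hx : Commute D (rep σ (x σ 1)))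
    (hy : Commute D (rep σ (y σ 1))) (z : GWA k σ 1) : Commute D (rep σ z) := by
  have := mem_of_generators σ 1 (S := (Subalgebra.centralizer k {D}).comap (rep σ))
    (fun p => by simpa [Subalgebra.mem_centralizer_iff] using (hr p).eq)
    (by simpa [Subalgebra.mem_centralizer_iff] using hx.eq)
    (by simpa [Subalgebra.mem_centralizer_iff] using hy.eq) z
  rw [Subalgebra.mem_comap, Subalgebra.mem_centralizer_iff] at this
  exact this D rfl

theorem coeff_mul_x (z : GWA k σ 1) (i : ℤ) : coeff σ (z * x σ 1) i = coeff σ z (i - 1) := by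
  let D : Module.End k (ℤ → LaurentPolynomial k) :=
    LinearMap.pi fun i => LinearMap.proj (i - 1)
  have hD : ∀ f i, D f i = f (i - 1) := fun _ _ => rfl
  have hc := rep_commute σ (D := D)
    (fun p => by ext f i : 2; simp [hD, rep_r])
    (by ext f i : 2; simp [hD, rep_x])
    (by ext f i : 2; simp [hD, rep_y]) z
  have hx : coeff σ (x σ 1) = D (Pi.single 0 1) := by
    ext1 j
    rw [coeff_apply, rep_x, hD]
    by_cases h : j - 1 = 0
    · simp [h]
    · simp [h]
  rw [coeff_mul, hx, ← Module.End.mul_apply, ← hc.eq]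
  rfl

theorem coeff_mul_r (z : GWA k σ 1) (p : LaurentPolynomial k) (i : ℤ) :
    coeff σ (z * r σ 1 p) i = (σ ^ i) p * coeff σ z i := by
  let D : Module.End k (ℤ → LaurentPolynomial k) :=
    LinearMap.pi fun i => (LinearMap.mulLeft k ((σ ^ i) p)).comp (LinearMap.proj i)
  have hD : ∀ f i, D f i = (σ ^ i) p * f i := fun _ _ => rfl
  have hc := rep_commute σ (D := D)
    (fun p => by ext f i : 2; simp [hD, rep_r, mul_left_comm])
    (by
      ext f i : 2
      have : σ ((σ ^ (i - 1)) p) = (σ ^ i) p := by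
        rw [← AlgEquiv.mul_apply, ← zpow_one_add, add_sub_cancel]
      simp [hD, rep_x, this])
    (by
      ext f i : 2
      have : σ.symm ((σ ^ (i + 1)) p) = (σ ^ i) p := by
        rw [add_comm, zpow_one_add, AlgEquiv.mul_apply, AlgEquiv.symm_apply_apply]
      simp [hD, rep_y, this]) z
  have hx : coeff σ (r σ 1 p) = D (Pi.single 0 1) := by
    ext1 j
    rw [coeff_apply, rep_r, hD]
    by_cases h : j = 0
    · simp [h]
    · simp [h]
  rw [coeff_mul, hx, ← Module.End.mul_apply, ← hc.eq]
  rfl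

theorem map_coeff_of_mem_center {z : GWA k σ 1} (hz : z ∈ Subalgebra.center k (GWA k σ 1))
    (i : ℤ) : σ (coeff σ z i) = coeff σ z i := by
  have h := congrFun (congrArg (coeff σ) (Subalgebra.mem_center_iff.1 hz (x σ 1))) (i + 1)
  rwa [coeff_mul_x, coeff_mul, rep_x, add_sub_cancel_right] at h

theorem mul_coeff_of_mem_center {z : GWA k σ 1} (hz : z ∈ Subalgebra.center k (GWA k σ 1))
    (p : LaurentPolynomial k) (i : ℤ) : p * coeff σ z i = (σ ^ i) p * coeff σ z i := by
  have h := congrFun (congrArg (coeff σ) (Subalgebra.mem_center_iff.1 hz (r σ 1 p))) i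
  rwa [coeff_mul_r, coeff_mul, rep_r] at h

end One

end GWA

namespace LaurentPolynomial

theorem coeff_C_mul_T {R : Type*} [Semiring R] (c : R) (n m : ℤ) :
    (C c * T n).coeff m = if n = m then c else 0 := by
  rw [← single_eq_C_mul_T]
  exact Finsupp.single_apply

theorem eq_invert {k : Type*} [CommRing k]
    {σ : LaurentPolynomial k ≃ₐ[k] LaurentPolynomial k} (hσ : σ (T 1) = T (-1)) : σ = invert := by
  have key : ∀ n : ℕ, σ (T n) = T (-n) := fun n => by
    have := T_pow (R := k) 1 n
    rw [mul_one] at this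
    rw [← this, map_pow, hσ, T_pow, mul_neg_one]
  ext1 f
  induction f using LaurentPolynomial.induction_on' with
  | add p q hp hq => rw [map_add, map_add, hp, hq]
  | C_mul_T n c =>
    rw [map_mul, map_mul, invert_C, invert_T, C_eq_algebraMap, AlgEquiv.commutes]
    congr 1
    obtain ⟨m, rfl | rfl⟩ := n.eq_nat_or_neg
    · exact key m
    · calc σ (T (-m)) = T m * (T (-m) * σ (T (-m))) := by
            rw [← mul_assoc, ← T_add, add_neg_cancel, T_zero, one_mul]
        _ = T m * σ (T m * T (-m)) := by rw [map_mul, key]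
        _ = T (- -m) := by rw [← T_add, add_neg_cancel, T_zero, map_one, mul_one, neg_neg]

section Invariants

variable (k : Type*) [CommRing k]

/-- Evaluation of polynomials at `T + T⁻¹`. -/
noncomputable def evalInvariant : Polynomial k →ₐ[k] LaurentPolynomial k :=
  Polynomial.aeval (T 1 + T (-1))

variable {k}

theorem T_add_T_neg_mem_range_evalInvariant (n : ℕ) :
    (T n + T (-n) : LaurentPolynomial k) ∈ (evalInvariant k).range := by
  refine ⟨Polynomial.dickson 1 1 n, ?_⟩
  have h := Polynomial.dickson_one_one_eval_add_inv (T 1 : LaurentPolynomial k) (T (-1))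
    (by rw [← T_add]; simp) n
  rw [T_pow, T_pow, mul_one, mul_neg_one] at h
  have hd := Polynomial.map_dickson (k := 1) (a := (1 : k)) (algebraMap k (LaurentPolynomial k)) n
  rw [map_one] at hd
  rw [← h, ← hd, Polynomial.eval_map_algebraMap]
  rfl

theorem mem_range_evalInvariant {f : LaurentPolynomial k} (hf : invert f = f) :
    f ∈ (evalInvariant k).range := by
  induction hn : f.coeff.support.card using Nat.strong_induction_on generalizing f with
  | _ N ih =>
  by_cases h0 : f = 0
  · rw [h0]; exact zero_mem _
  obtain ⟨n, hnf⟩ : ∃ n, f.coeff n ≠ 0 := by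
    by_contra! h
    exact h0 (LaurentPolynomial.ext h)
  have hsymm (m : ℤ) : f.coeff (-m) = f.coeff m := by
    conv_rhs => rw [← hf]
    simp
  obtain ⟨t, ht, ht', htn, hts⟩ : ∃ t ∈ (evalInvariant k).range, invert t = t ∧
      t.coeff n = f.coeff n ∧ ∀ m, f.coeff m = 0 → t.coeff m = 0 := by
    by_cases hn0 : n = 0
    · subst hn0
      refine ⟨C (f.coeff 0), ?_, invert_C _, by simp, fun m hm => ?_⟩
      · rw [C_eq_algebraMap]; exact Subalgebra.algebraMap_mem _ _
      · have : m ≠ 0 := by rintro rfl; exact hnf hm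
        simp [this]
    · refine ⟨f.coeff n • (T n + T (-n)), Subalgebra.smul_mem _ ?_ _, ?_, ?_, fun m hm => ?_⟩
      · obtain ⟨j, rfl | rfl⟩ := n.eq_nat_or_neg
        · exact T_add_T_neg_mem_range_evalInvariant j
        · rw [neg_neg, add_comm]; exact T_add_T_neg_mem_range_evalInvariant j
      · simp [add_comm]
      · have : -n ≠ n := by lia
        simp [this]
      · have h1 : n ≠ m := by rintro rfl; exact hnf hm
        have h2 : -n ≠ m := by rintro rfl; exact hnf ((hsymm n).symm.trans hm)
        simp [h1, h2]
  have hlt : (f - t).coeff.support.card < N := by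
    rw [← hn]
    refine Finset.card_lt_card (Finset.ssubset_iff_of_subset (fun m hm => ?_) |>.2 ⟨n, ?_, ?_⟩)
    · rw [Finsupp.mem_support_iff] at hm ⊢
      intro h
      simp [h, hts m h] at hm
    · simpa using hnf
    · simp [htn]
  have := ih _ hlt (f := f - t) (by rw [map_sub, hf, ht']) rfl
  simpa using add_mem this ht

theorem evalInvariant_injective (k : Type*) [Field k] :
    Function.Injective (evalInvariant k) := by
  refine transcendental_iff_injective.1 fun halg => ?_
  let s : integralClosure k (LaurentPolynomial k) := ⟨_, halg.isIntegral⟩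
  have hT : IsIntegral (integralClosure k (LaurentPolynomial k)) (T 1 : LaurentPolynomial k) := by
    refine ⟨Polynomial.X ^ 2 + (Polynomial.C (-s) * Polynomial.X + Polynomial.C 1), ?_, ?_⟩
    · refine Polynomial.monic_X_pow_add (lt_of_le_of_lt Polynomial.degree_linear_le ?_)
      norm_num
    · have h1 : (T 1 * T (-1) : LaurentPolynomial k) = 1 := by rw [← T_add]; simp
      have hs : algebraMap (integralClosure k (LaurentPolynomial k)) (LaurentPolynomial k) (-s) =
          -(T 1 + T (-1)) := rfl
      simp only [Polynomial.eval₂_add, Polynomial.eval₂_mul, Polynomial.eval₂_pow,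
        Polynomial.eval₂_X, Polynomial.eval₂_C, hs, Polynomial.C_1,
        Polynomial.eval₂_one]
      linear_combination -h1
  obtain ⟨p, hp, hp0⟩ := (isIntegral_trans (R := k) _ hT).isAlgebraic
  refine hp (Polynomial.toLaurent_injective ?_)
  rw [map_zero, ← hp0, ← Polynomial.toLaurentAlg_apply, ← Polynomial.toLaurent_X,
    ← Polynomial.toLaurentAlg_apply, Polynomial.aeval_algHom_apply, Polynomial.aeval_X_left_apply]

end Invariants

theorem invert_zpow_two_mul {k : Type*} [CommRing k] (m : ℤ) :
    (invert : LaurentPolynomial k ≃ₐ[k] LaurentPolynomial k) ^ (2 * m) = 1 := by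
  have : (invert : LaurentPolynomial k ≃ₐ[k] LaurentPolynomial k) ^ (2 : ℤ) = 1 := by
    rw [zpow_ofNat, sq]
    ext1 f
    exact involutive_invert f
  rw [zpow_mul, this, one_zpow]

end LaurentPolynomial

namespace GWA

section Center

variable {k : Type*} [CommRing k]

theorem r_mem_center {f : LaurentPolynomial k} (hf : invert f = f) :
    r invert 1 f ∈ Subalgebra.center k (GWA k invert 1) := by
  refine mem_center_of_commute invert 1 (fun p => ?_) ?_ ?_
  · rw [commute_iff_eq, ← r_mul, ← r_mul, mul_comm]
  · rw [commute_iff_eq, x_mul_r, hf]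
  · rw [commute_iff_eq, y_mul_r, invert_symm, hf]

theorem x_mul_x_mem_center :
    x invert 1 * x invert 1 ∈ Subalgebra.center k (GWA k invert 1) := by
  refine mem_center_of_commute invert 1 (fun p => ?_) ?_ ?_
  · rw [commute_iff_eq, mul_assoc (x _ _), x_mul_r, ← mul_assoc (x _ _), x_mul_r, involutive_invert,
      mul_assoc]
  · exact (Commute.refl _).mul_right (Commute.refl _)
  · have : Commute (y invert 1) (x invert (1 : LaurentPolynomial k)) := by
      rw [commute_iff_eq, x_mul_y, y_mul_x, map_one]
    exact this.mul_right this

theorem y_mul_y_mem_center :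
    y invert 1 * y invert 1 ∈ Subalgebra.center k (GWA k invert 1) := by
  refine mem_center_of_commute invert 1 (fun p => ?_) ?_ ?_
  · rw [commute_iff_eq, mul_assoc (y _ _), y_mul_r, ← mul_assoc (y _ _), y_mul_r, invert_symm,
      involutive_invert, mul_assoc]
  · have : Commute (x invert 1) (y invert (1 : LaurentPolynomial k)) := by
      rw [commute_iff_eq, x_mul_y, y_mul_x, map_one]
    exact this.mul_right this
  · exact (Commute.refl _).mul_right (Commute.refl _)

theorem invert_evalInvariant (p : Polynomial k) :
    invert (evalInvariant k p) = evalInvariant k p := by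
  rw [evalInvariant, ← Polynomial.aeval_algHom_apply, map_add, invert_T, invert_T, neg_neg,
    add_comm]

variable (k) in
/-- The map `k[t] → Z(A)` with `t ↦ h + h⁻¹`. -/
noncomputable def centerC : Polynomial k →ₐ[k] Subalgebra.center k (GWA k invert 1) :=
  ((rHom invert 1).comp (evalInvariant k)).codRestrict _
    fun p => r_mem_center (invert_evalInvariant p)

variable (k) in
/-- The unit `x²` of the center. -/
noncomputable def centerUnit : (Subalgebra.center k (GWA k invert 1))ˣ where
  val := ⟨_, x_mul_x_mem_center⟩
  inv := ⟨_, y_mul_y_mem_center⟩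
  val_inv := Subtype.ext (xUnit invert * xUnit invert).val_inv
  inv_val := Subtype.ext (xUnit invert * xUnit invert).inv_val

theorem coe_centerUnit_zpow (n : ℤ) :
    (((centerUnit k ^ n : (Subalgebra.center k (GWA k invert 1))ˣ) :
      Subalgebra.center k (GWA k invert 1)) : GWA k invert 1) =
      ((xUnit invert ^ (2 * n) : (GWA k invert 1)ˣ) : GWA k invert 1) := by
  have h : Units.map (Subalgebra.center k (GWA k invert 1)).val.toMonoidHom (centerUnit k) =
      xUnit invert ^ (2 : ℤ) := by
    ext
    rw [zpow_ofNat, sq]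
    rfl
  rw [zpow_mul, ← h, ← map_zpow]
  rfl

variable (k) in
/-- The map `k[t][s^{±1}] → Z(A)` with `t ↦ h + h⁻¹` and `s ↦ x²`. -/
noncomputable def toCenter :
    LaurentPolynomial (Polynomial k) →ₐ[k] Subalgebra.center k (GWA k invert 1) where
  __ := LaurentPolynomial.eval₂ (centerC k).toRingHom (centerUnit k)
  commutes' c := by
    change LaurentPolynomial.eval₂ (centerC k).toRingHom (centerUnit k) _ = _
    rw [LaurentPolynomial.algebraMap_apply, eval₂_C]
    exact (centerC k).commutes c

theorem toCenter_C (p : Polynomial k) : toCenter k (C p) = centerC k p :=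
  eval₂_C ..

theorem toCenter_T (n : ℤ) :
    toCenter k (T n) = (centerUnit k ^ n : (Subalgebra.center k (GWA k invert 1))ˣ) :=
  eval₂_T ..

theorem coeff_toCenter (q : LaurentPolynomial (Polynomial k)) (n : ℤ) :
    coeff invert (toCenter k q : GWA k invert 1) (2 * n) = evalInvariant k (q.coeff n) := by
  induction q using LaurentPolynomial.induction_on' with
  | add p q hp hq => simp [hp, hq]
  | C_mul_T m p =>
    have : ((toCenter k (C p * T m) : Subalgebra.center k (GWA k invert 1)) : GWA k invert 1) =
        r invert 1 (evalInvariant k p) *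
          ((xUnit invert ^ (2 * m) : (GWA k invert 1)ˣ) : GWA k invert 1) := by
      rw [map_mul, toCenter_C, toCenter_T, Subalgebra.coe_mul, coe_centerUnit_zpow]
      rfl
    rw [this, coeff_mul, coeff_xUnit_zpow, rep_r, coeff_C_mul_T]
    by_cases h : n = m
    · subst h; simp
    · rw [Pi.single_eq_of_ne (by lia), mul_zero, if_neg (Ne.symm h), map_zero]

theorem coe_toCenter_X :
    (toCenter k (C Polynomial.X) : GWA k invert 1) = H invert 1 + Hinv invert 1 := by
  rw [toCenter_C]
  change rHom invert 1 (evalInvariant k Polynomial.X) = _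
  rw [evalInvariant, Polynomial.aeval_X, map_add]
  rfl

theorem coe_toCenter_T_one :
    (toCenter k (T 1) : GWA k invert 1) = x invert 1 * x invert 1 := by
  rw [toCenter_T, zpow_one]
  rfl

theorem coe_toCenter_T_neg_one :
    (toCenter k (T (-1)) : GWA k invert 1) = y invert 1 * y invert 1 := by
  rw [toCenter_T, zpow_neg_one]
  rfl

theorem toCenter_injective (k : Type*) [Field k] : Function.Injective (toCenter k) := by
  intro p q h
  ext1 n
  apply evalInvariant_injective k
  rw [← coeff_toCenter, ← coeff_toCenter, h]

/-- Central elements have coefficients supported in even degrees. -/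
theorem coeff_eq_zero_of_odd {k : Type*} [Field k] {z : GWA k invert 1}
    (hz : z ∈ Subalgebra.center k (GWA k invert 1)) (m : ℤ) :
    coeff invert z (2 * m + 1) = 0 := by
  have h := mul_coeff_of_mem_center invert hz (T 1) (2 * m + 1)
  rw [zpow_add_one, invert_zpow_two_mul, one_mul, invert_T] at h
  by_contra h0
  have h1 := congrArg (fun f : LaurentPolynomial k => f.coeff 1) (mul_right_cancel₀ h0 h)
  simp at h1

theorem mem_range_of_mem_center {k : Type*} [Field k] {z : GWA k invert 1}
    (hz : z ∈ Subalgebra.center k (GWA k invert 1)) :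
    ∃ q, (toCenter k q : GWA k invert 1) = z := by
  change z ∈ ((Subalgebra.center k (GWA k invert 1)).val.comp (toCenter k)).range
  obtain ⟨f, rfl⟩ := ofCoeff_surjective invert z
  rw [← f.sum_single, Finsupp.sum, map_sum]
  refine sum_mem fun i _ => ?_
  have hf := coeff_ofCoeff invert f
  rw [ofCoeff_single]
  obtain ⟨m, rfl | rfl⟩ := i.even_or_odd'
  · obtain ⟨p, hp⟩ := mem_range_evalInvariant (map_coeff_of_mem_center invert hz (2 * m))
    rw [hf] at hp
    rw [← hp, ← coe_centerUnit_zpow]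
    refine ⟨C p * T m, ?_⟩
    rw [← toCenter_T]
    change (toCenter k (C p * T m) : GWA k invert 1) = _
    rw [map_mul, Subalgebra.coe_mul, toCenter_C]
    rfl
  · rw [← hf, coeff_eq_zero_of_odd hz, ← rHom_apply, map_zero, zero_mul]
    exact zero_mem _

theorem coe_toCenter_mem_adjoin (q : LaurentPolynomial (Polynomial k)) :
    (toCenter k q : GWA k invert 1) ∈ Algebra.adjoin k
      ({H invert 1 + Hinv invert 1, x invert 1 * x invert 1, y invert 1 * y invert 1} :
        Set (GWA k invert 1)) := by
  induction q using LaurentPolynomial.induction_on' with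
  | add p q hp hq => rw [map_add]; exact add_mem hp hq
  | C_mul_T n p =>
    rw [map_mul]
    refine mul_mem ?_ ?_
    · have hp : (toCenter k (C p) : GWA k invert 1) =
          Polynomial.aeval (H invert 1 + Hinv invert 1) p := by
        rw [← coe_toCenter_X, toCenter_C, toCenter_C]
        change _ = Polynomial.aeval
          ((Subalgebra.center k (GWA k invert 1)).val.comp (centerC k) Polynomial.X) p
        rw [Polynomial.aeval_algHom_apply, Polynomial.aeval_X_left_apply]
        rfl
      rw [hp]
      exact Algebra.adjoin_mono (by simp) (Polynomial.aeval_mem_adjoin_singleton k _)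
    · obtain ⟨m, rfl | rfl⟩ := n.eq_nat_or_neg
      · rw [← mul_one (m : ℤ), ← T_pow, map_pow, Subalgebra.coe_pow, coe_toCenter_T_one]
        exact pow_mem (Algebra.subset_adjoin (by simp)) m
      · rw [← mul_neg_one (m : ℤ), ← T_pow, map_pow, Subalgebra.coe_pow, coe_toCenter_T_neg_one]
        exact pow_mem (Algebra.subset_adjoin (by simp)) m

end Center

end GWA

/-- In `A = k[h^{±1}](σ_inv, 1)` with `σ_inv(h) = h⁻¹`, the center of `A` is
the `k`-subalgebra generated by `h + h⁻¹`, `x²` and `x⁻² = y²`, and it is isomorphic to the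
Laurent polynomial ring `k[t][s^{±1}]` via `t ↦ h + h⁻¹`, `s ↦ x²`. -/
theorem center_involution_gwa_one (k : Type*) [Field k]
    (σ : LaurentPolynomial k ≃ₐ[k] LaurentPolynomial k) (hσ : σ (T 1) = T (-1)) :
    Algebra.adjoin k
        ({GWA.H σ 1 + GWA.Hinv σ 1, GWA.x σ 1 * GWA.x σ 1, GWA.y σ 1 * GWA.y σ 1} :
          Set (GWA k σ 1)) = Subalgebra.center k (GWA k σ 1) ∧
      ∃ e : LaurentPolynomial (Polynomial k) ≃ₐ[k] Subalgebra.center k (GWA k σ 1),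
        ((e (C Polynomial.X) : Subalgebra.center k (GWA k σ 1)) : GWA k σ 1) =
            GWA.H σ 1 + GWA.Hinv σ 1 ∧
          ((e (T 1) : Subalgebra.center k (GWA k σ 1)) : GWA k σ 1) =
            GWA.x σ 1 * GWA.x σ 1 := by
  obtain rfl := LaurentPolynomial.eq_invert hσ
  refine ⟨le_antisymm (Algebra.adjoin_le ?_) fun z hz => ?_,
    AlgEquiv.ofBijective (GWA.toCenter k) ⟨GWA.toCenter_injective k, fun z => ?_⟩,
    GWA.coe_toCenter_X, GWA.coe_toCenter_T_one⟩
  · rintro _ (rfl | rfl | rfl)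
    · rw [← GWA.coe_toCenter_X]; exact Subtype.coe_prop _
    · exact GWA.x_mul_x_mem_center
    · exact GWA.y_mul_y_mem_center
  · obtain ⟨q, rfl⟩ := GWA.mem_range_of_mem_center hz
    exact GWA.coe_toCenter_mem_adjoin q
  · obtain ⟨q, hq⟩ := GWA.mem_range_of_mem_center z.2
    exact ⟨q, Subtype.ext hq⟩
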